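/- Discrete state and flow equations for the Drucker–Prager smooth return: in the smooth-return case (Ψ(σ^tr) > 0 and η p^tr − (Kη²/(G√2)) ρ^tr < c), the updates satisfy Δλ > 0, σ_k = ℂ(ε_k − ε^p_k), and ε^p_k − ε^p_{k−1} = Δλ·((1/√2) n^tr + (η/3) I). -/

import Mathlib

open Matrix

/-- Frobenius inner product on 3×3 real matrices. -/
noncomputable def frob (σ τ : Matrix (Fin 3) (Fin 3) ℝ) : ℝ := ∑ i, ∑ j, σ i j * τ i j

/-- Frobenius norm. -/
noncomputable def fnorm (τ : Matrix (Fin 3) (Fin 3) ℝ) : ℝ := Real.sqrt (frob τ τ)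

/-- Deviatoric part. -/
noncomputable def devM (τ : Matrix (Fin 3) (Fin 3) ℝ) : Matrix (Fin 3) (Fin 3) ℝ :=
  τ - (Matrix.trace τ / 3) • (1 : Matrix (Fin 3) (Fin 3) ℝ)

/-- The isotropic elasticity tensor `ℂε = K tr(ε) I + 2G dev(ε)`. -/
noncomputable def Celast (K G : ℝ) (ε : Matrix (Fin 3) (Fin 3) ℝ) : Matrix (Fin 3) (Fin 3) ℝ :=
  (K * Matrix.trace ε) • (1 : Matrix (Fin 3) (Fin 3) ℝ) + (2 * G) • devM ε

/-- The Drucker–Prager yield function `Ψ(τ) = √(1/2)|dev τ| + (η/3) tr τ − c`. -/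
noncomputable def PsiDP (η c : ℝ) (τ : Matrix (Fin 3) (Fin 3) ℝ) : ℝ :=
  Real.sqrt (1 / 2) * fnorm (devM τ) + η / 3 * Matrix.trace τ - c

theorem trace_devM (τ : Matrix (Fin 3) (Fin 3) ℝ) : Matrix.trace (devM τ) = 0 := by
  simp [devM, Matrix.trace_sub, Matrix.trace_smul]

theorem Celast_sub (K G : ℝ) (σ τ : Matrix (Fin 3) (Fin 3) ℝ) :
    Celast K G (σ - τ) = Celast K G σ - Celast K G τ := by
  simp only [Celast, devM, Matrix.trace_sub]
  module

/-- The elasticity tensor acts on a trace-free matrix as multiplication by `2G` and on the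
identity as multiplication by `3K`. -/
theorem Celast_smul_add_smul_one (K G a b : ℝ) {n : Matrix (Fin 3) (Fin 3) ℝ}
    (hn : Matrix.trace n = 0) :
    Celast K G (a • n + b • (1 : Matrix (Fin 3) (Fin 3) ℝ)) =
      (2 * G * a) • n + (3 * K * b) • (1 : Matrix (Fin 3) (Fin 3) ℝ) := by
  have htr : Matrix.trace (a • n + b • (1 : Matrix (Fin 3) (Fin 3) ℝ)) = 3 * b := by
    simp [Matrix.trace_add, Matrix.trace_smul, hn, mul_comm]
  simp only [Celast, devM, htr]
  module

/-- Discrete state and flow equations for the Drucker–Prager smooth return: in the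
smooth-return case `Δλ > 0`, `σₖ = ℂ(εₖ − εₖᵖ)` and
`εₖᵖ − εₖ₋₁ᵖ = Δλ((1/√2) n^tr + (η/3) I)`. -/
theorem druckerPrager_smooth_return_flow (K G η c : ℝ)
    (hK : 0 < K) (hG : 0 < G) (hη : 0 < η) (hc : 0 < c)
    (εk εp : Matrix (Fin 3) (Fin 3) ℝ) (hεk : εk.IsSymm) (hεp : εp.IsSymm)
    (σtr str ntr σk εpk : Matrix (Fin 3) (Fin 3) ℝ) (ρtr ptr Δlam : ℝ)
    (hσtr : σtr = Celast K G (εk - εp))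
    (hstr : str = devM σtr) (hρtr : ρtr = fnorm str)
    (hptr : ptr = Matrix.trace σtr / 3)
    (hcase1 : 0 < PsiDP η c σtr)
    (hcase2 : η * ptr - K * η ^ 2 / (G * Real.sqrt 2) * ρtr < c)
    (hntr : ntr = ρtr⁻¹ • str)
    (hΔlam : Δlam = PsiDP η c σtr / (G + K * η ^ 2))
    (hσk : σk = σtr - (Δlam * (G * Real.sqrt 2)) • ntr -
      (Δlam * (K * η)) • (1 : Matrix (Fin 3) (Fin 3) ℝ))
    (hεpk : εpk = εp + (Δlam * (Real.sqrt 2)⁻¹) • ntr +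
      (Δlam * (η / 3)) • (1 : Matrix (Fin 3) (Fin 3) ℝ)) :
    0 < Δlam ∧ σk = Celast K G (εk - εpk) ∧
    εpk - εp = (Δlam * (Real.sqrt 2)⁻¹) • ntr +
      (Δlam * (η / 3)) • (1 : Matrix (Fin 3) (Fin 3) ℝ) := by
  have hflow : εpk - εp = (Δlam * (Real.sqrt 2)⁻¹) • ntr +
      (Δlam * (η / 3)) • (1 : Matrix (Fin 3) (Fin 3) ℝ) := by
    rw [hεpk]
    abel
  refine ⟨by rw [hΔlam]; positivity, ?_, hflow⟩
  have hn : Matrix.trace ntr = 0 := by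
    rw [hntr, hstr, Matrix.trace_smul, trace_devM, smul_zero]
  have hshear : 2 * G * (Δlam * (Real.sqrt 2)⁻¹) = Δlam * (G * Real.sqrt 2) := by
    have h2 : Real.sqrt 2 ^ 2 = 2 := Real.sq_sqrt zero_le_two
    field_simp
    rw [h2, mul_comm]
  have hbulk : 3 * K * (Δlam * (η / 3)) = Δlam * (K * η) := by ring
  rw [← sub_sub_sub_cancel_right εk εpk εp, Celast_sub, ← hσtr, hflow,
    Celast_smul_add_smul_one K G _ _ hn, hshear, hbulk, hσk, sub_sub]
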